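/- Let X, Y be nonzero order-D real tensors of the same size, and suppose that for every mode d there exist orthogonal matrices U^(d) and V^(d) with X_(d) = U^(d) · Diag(σ^(d)(X)) · (V^(d))ᵀ and Y_(d) = U^(d) · Diag(σ^(d)(Y)) · (V^(d))ᵀ (simultaneous ordered singular value decompositions of all matricizations). Let r_x^(d) = rank(X_(d)) and r_y^(d) = rank(Y_(d)). Then exactly one of the following holds: r_x^(d) > r_y^(d) for all d = 1,…,D; or r_x^(d) < r_y^(d) for all d = 1,…,D; or r_x^(d) = r_y^(d) for all d = 1,…,D. -/

import Mathlib

open scoped BigOperators Matrix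

/-- The entries of `v` sorted in nonincreasing order. -/
noncomputable def sortDesc {m : ℕ} (v : Fin m → ℝ) : Fin m → ℝ :=
  fun k => (v ∘ Tuple.sort v) k.rev

theorem gram_isHermitian {m : ℕ} {J : Type*} [Fintype J]
    (A : Matrix (Fin m) J ℝ) : (A * Aᵀ).IsHermitian := by
  ext i j
  simp [Matrix.conjTranspose_apply, Matrix.mul_apply, Matrix.transpose_apply, mul_comm]

/-- Singular values of a real matrix `A`: the square roots of the eigenvalues of
the positive semidefinite matrix `A * Aᵀ`, in nonincreasing order. -/
noncomputable def singularValues {m : ℕ} {J : Type*} [Fintype J]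
    (A : Matrix (Fin m) J ℝ) : Fin m → ℝ :=
  fun k => Real.sqrt (sortDesc (gram_isHermitian A).eigenvalues k)

variable {D : ℕ} {n : Fin D → ℕ}

/-- Inner product of two tensors. -/
noncomputable def tinner (X Y : (∀ d, Fin (n d)) → ℝ) : ℝ :=
  ∑ i : ∀ d, Fin (n d), X i * Y i

/-- Mode-`d` matricization of the tensor `X`. -/
def matricize (X : (∀ d, Fin (n d)) → ℝ) (d : Fin D) :
    Matrix (Fin (n d)) (∀ d' : {d' : Fin D // d' ≠ d}, Fin (n d')) ℝ :=
  Matrix.of fun k j =>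
    X (fun d' => if h : d' = d then Fin.cast (congrArg n h.symm) k else j ⟨d', h⟩)

/-- Mode-`d` singular values of a tensor. -/
noncomputable def modeSV (X : (∀ d, Fin (n d)) → ℝ) (d : Fin D) : Fin (n d) → ℝ :=
  singularValues (matricize X d)

/-- The multilinear (Tucker) product `X ×₁ U 1 ×₂ ⋯ ×_D U D`. -/
noncomputable def tuckerMul (X : (∀ d, Fin (n d)) → ℝ)
    (U : ∀ d, Matrix (Fin (n d)) (Fin (n d)) ℝ) : (∀ d, Fin (n d)) → ℝ :=
  fun i => ∑ j : ∀ d, Fin (n d), (∏ d, U d (i d) (j d)) * X j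

/-- Rectangular "diagonal" matrix with columns indexed by an arbitrary fintype,
identified with an initial segment of `ℕ` via `Fintype.equivFin`. -/
noncomputable def rectDiagJ {m : ℕ} {J : Type*} [Fintype J]
    (v : Fin m → ℝ) : Matrix (Fin m) J ℝ :=
  Matrix.of fun k j => if ((Fintype.equivFin J) j : ℕ) = (k : ℕ) then v k else 0

theorem singularValues_antitone {m : ℕ} {J : Type*} [Fintype J] (A : Matrix (Fin m) J ℝ) :
    Antitone (singularValues A) := fun _ _ h =>
  Real.sqrt_le_sqrt (Tuple.monotone_sort (gram_isHermitian A).eigenvalues (Fin.rev_le_rev.2 h))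

theorem card_singularValues_ne_zero {m : ℕ} {J : Type*} [Fintype J] (A : Matrix (Fin m) J ℝ) :
    (Finset.univ.filter fun k => singularValues A k ≠ 0).card = A.rank := by
  have hpos : (A * Aᵀ).PosSemidef := by
    simpa [Matrix.conjTranspose_eq_transpose_of_trivial] using
      Matrix.posSemidef_self_mul_conjTranspose A
  rw [← Matrix.rank_self_mul_transpose A,
    (gram_isHermitian A).rank_eq_card_non_zero_eigs, ← Fintype.card_subtype]
  refine Fintype.card_congr
    ((Fin.revPerm.trans (Tuple.sort (gram_isHermitian A).eigenvalues)).subtypeEquiv fun k => ?_)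
  have h0 : 0 ≤ sortDesc (gram_isHermitian A).eigenvalues k := hpos.eigenvalues_nonneg _
  exact not_congr (Real.sqrt_eq_zero h0)

theorem lt_rank_of_singularValues_ne_zero {m : ℕ} {J : Type*} [Fintype J]
    (A : Matrix (Fin m) J ℝ) {k : Fin m} (hk : singularValues A k ≠ 0) : (k : ℕ) < A.rank := by
  rw [← card_singularValues_ne_zero A, Nat.lt_iff_add_one_le, ← Fin.card_Iic]
  refine Finset.card_le_card fun l hl => ?_
  have hle := singularValues_antitone A (Finset.mem_Iic.1 hl)
  have hpos : 0 < singularValues A k := lt_of_le_of_ne (Real.sqrt_nonneg _) hk.symm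
  simpa using (hpos.trans_le hle).ne'

theorem singularValues_ne_zero_iff {m : ℕ} {J : Type*} [Fintype J]
    (A : Matrix (Fin m) J ℝ) {k : Fin m} : singularValues A k ≠ 0 ↔ (k : ℕ) < A.rank := by
  refine ⟨lt_rank_of_singularValues_ne_zero A, fun hlt hk => hlt.not_ge ?_⟩
  rw [← card_singularValues_ne_zero A, ← Fin.card_Iio]
  refine Finset.card_le_card fun l hl => Finset.mem_Iio.2 (lt_of_not_ge fun hkl => ?_)
  have hle := singularValues_antitone A hkl
  exact (Finset.mem_filter.1 hl).2 (le_antisymm (hle.trans hk.le) (Real.sqrt_nonneg _))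

/-- Contraction of mode `d` of a tensor with a vector. -/
def modeContract (d : Fin D) (u : Fin (n d) → ℝ) :
    ((∀ d, Fin (n d)) → ℝ) →ₗ[ℝ] ((∀ d, Fin (n d)) → ℝ) where
  toFun X := fun i => ∑ a, u a * X (Function.update i d a)
  map_add' X Y := by
    ext i
    simp [mul_add, Finset.sum_add_distrib]
  map_smul' c X := by
    ext i
    simp [Finset.mul_sum, mul_left_comm]

theorem modeContract_comm {d e : Fin D} (h : d ≠ e) (u : Fin (n d) → ℝ) (v : Fin (n e) → ℝ)
    (X : (∀ d, Fin (n d)) → ℝ) :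
    modeContract d u (modeContract e v X) = modeContract e v (modeContract d u X) := by
  ext i
  simp only [modeContract, LinearMap.coe_mk, AddHom.coe_mk, Finset.mul_sum]
  rw [Finset.sum_comm]
  refine Finset.sum_congr rfl fun b _ => Finset.sum_congr rfl fun a _ => ?_
  rw [Function.update_comm h, mul_left_comm]

/-- A tensor vanishes if all its contractions with the columns of an orthogonal matrix do. -/
theorem eq_zero_of_modeContract_eq_zero (d : Fin D) {W : Matrix (Fin (n d)) (Fin (n d)) ℝ}
    (hW : W * Wᵀ = 1) {X : (∀ d, Fin (n d)) → ℝ}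
    (hX : ∀ k, modeContract d (fun a => W a k) X = 0) : X = 0 := by
  ext i
  have hz : Wᵀ *ᵥ (fun a => X (Function.update i d a)) = 0 := by
    ext k
    exact congrFun (hX k) i
  have h := congrArg (W *ᵥ ·) hz
  simp only [Matrix.mulVec_mulVec, hW, Matrix.one_mulVec, Matrix.mulVec_zero] at h
  simpa using congrFun h (i d)

theorem matricize_restrict (X : (∀ d, Fin (n d)) → ℝ) (d : Fin D) (a : Fin (n d))
    (i : ∀ d, Fin (n d)) :
    matricize X d a (fun d' => i d') = X (Function.update i d a) := by
  refine congrArg X (funext fun d' => ?_)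
  by_cases h : d' = d
  · subst h
    simp
  · simp [h]

theorem modeContract_apply (X : (∀ d, Fin (n d)) → ℝ) (d : Fin D)
    (W : Matrix (Fin (n d)) (Fin (n d)) ℝ) (k : Fin (n d)) (i : ∀ d, Fin (n d)) :
    modeContract d (fun a => W a k) X i = (Wᵀ * matricize X d) k (fun d' => i d') := by
  simp [modeContract, Matrix.mul_apply, matricize_restrict]

theorem rectDiagJ_mul_apply {m : ℕ} {J L : Type*} [Fintype J] (v : Fin m → ℝ)
    (B : Matrix J L ℝ) (k : Fin m) (l : L) :
    ((rectDiagJ v : Matrix (Fin m) J ℝ) * B) k l =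
      v k * ((rectDiagJ 1 : Matrix (Fin m) J ℝ) * B) k l := by
  simp [rectDiagJ, Matrix.mul_apply, Finset.mul_sum]

theorem modeContract_of_svd {X : (∀ d, Fin (n d)) → ℝ} {d : Fin D}
    {W : Matrix (Fin (n d)) (Fin (n d)) ℝ} (hW : W * Wᵀ = 1)
    {V : Matrix (∀ d' : {d' : Fin D // d' ≠ d}, Fin (n d'))
      (∀ d' : {d' : Fin D // d' ≠ d}, Fin (n d')) ℝ} {s : Fin (n d) → ℝ}
    (hX : matricize X d =
      W * rectDiagJ (J := ∀ d' : {d' : Fin D // d' ≠ d}, Fin (n d')) s * Vᵀ) (k : Fin (n d)) :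
    modeContract d (fun a => W a k) X = s k • fun i : ∀ d, Fin (n d) =>
      ((rectDiagJ 1 : Matrix (Fin (n d)) (∀ d' : {d' : Fin D // d' ≠ d}, Fin (n d')) ℝ) * Vᵀ) k
        (fun d' => i d') := by
  ext i
  rw [modeContract_apply, hX, Matrix.mul_assoc, ← Matrix.mul_assoc, mul_eq_one_comm.1 hW,
    Matrix.one_mul, rectDiagJ_mul_apply]
  rfl

theorem modeContract_ne_zero {X : (∀ d, Fin (n d)) → ℝ} {d : Fin D}
    {W : Matrix (Fin (n d)) (Fin (n d)) ℝ} (hW : W * Wᵀ = 1)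
    {V : Matrix (∀ d' : {d' : Fin D // d' ≠ d}, Fin (n d'))
      (∀ d' : {d' : Fin D // d' ≠ d}, Fin (n d')) ℝ} (hV : V * Vᵀ = 1)
    (hX : matricize X d =
      W * rectDiagJ (J := ∀ d' : {d' : Fin D // d' ≠ d}, Fin (n d')) (modeSV X d) * Vᵀ) {k : Fin (n d)}
    (hk : modeSV X d k ≠ 0) : modeContract d (fun a => W a k) X ≠ 0 := by
  intro h0
  have hrow : ((rectDiagJ (modeSV X d) :
      Matrix (Fin (n d)) (∀ d' : {d' : Fin D // d' ≠ d}, Fin (n d')) ℝ) * Vᵀ) k = 0 := by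
    ext j
    have h := congrFun h0 fun d' => if h : d' = d then Fin.cast (congrArg n h.symm) k else j ⟨d', h⟩
    rw [modeContract_apply, hX, Matrix.mul_assoc, ← Matrix.mul_assoc, mul_eq_one_comm.1 hW,
      Matrix.one_mul] at h
    convert h using 2
    · ext d'
      simp [d'.2]
    · rfl
  have hdiag : (rectDiagJ (modeSV X d) :
      Matrix (Fin (n d)) (∀ d' : {d' : Fin D // d' ≠ d}, Fin (n d')) ℝ) k = 0 := by
    have h := congrArg (· ᵥ* V) hrow
    simpa only [Matrix.mul_apply_eq_vecMul, Matrix.vecMul_vecMul,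
      mul_eq_one_comm.1 hV, Matrix.vecMul_one, Matrix.zero_vecMul] using h
  have hlt := (lt_rank_of_singularValues_ne_zero _ hk).trans_le (Matrix.rank_le_card_width _)
  have h := congrFun hdiag ((Fintype.equivFin _).symm ⟨k, hlt⟩)
  simp [rectDiagJ, hk] at h

/-- For tensors with simultaneous singular value decompositions, a strict inequality between the
ranks in one mode propagates to every mode. -/
theorem rank_lt_of_rank_lt {X Y : (∀ d, Fin (n d)) → ℝ}
    {U : ∀ d, Matrix (Fin (n d)) (Fin (n d)) ℝ} (hU : ∀ d, U d * (U d)ᵀ = 1)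
    (hSVD : ∀ d : Fin D,
      ∃ V : Matrix (∀ d' : {d' : Fin D // d' ≠ d}, Fin (n d'))
                   (∀ d' : {d' : Fin D // d' ≠ d}, Fin (n d')) ℝ,
        V * Vᵀ = 1 ∧
        matricize X d =
          U d * rectDiagJ (J := ∀ d' : {d' : Fin D // d' ≠ d}, Fin (n d')) (modeSV X d) * Vᵀ ∧
        matricize Y d =
          U d * rectDiagJ (J := ∀ d' : {d' : Fin D // d' ≠ d}, Fin (n d')) (modeSV Y d) * Vᵀ)
    {d : Fin D} (hd : (matricize Y d).rank < (matricize X d).rank) (e : Fin D) :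
    (matricize Y e).rank < (matricize X e).rank := by
  rcases eq_or_ne d e with rfl | hde
  · exact hd
  by_contra! hle
  obtain ⟨V, hV, hXd, hYd⟩ := hSVD d
  obtain ⟨V', -, hXe, hYe⟩ := hSVD e
  let k : Fin (n d) := ⟨(matricize Y d).rank,
    hd.trans_le ((Matrix.rank_le_card_height _).trans_eq (Fintype.card_fin _))⟩
  have hXk : modeSV X d k ≠ 0 := (singularValues_ne_zero_iff _).2 hd
  have hYk : modeSV Y d k = 0 := by
    by_contra h
    exact lt_irrefl _ ((singularValues_ne_zero_iff _).1 h)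
  have hY0 : modeContract d (fun a => U d a k) Y = 0 := by
    rw [modeContract_of_svd (hU d) hYd, hYk, zero_smul]
  refine modeContract_ne_zero (hU d) hV hXd hXk
    (eq_zero_of_modeContract_eq_zero e (hU e) fun l => ?_)
  rw [← modeContract_comm hde, modeContract_of_svd (hU e) hXe, map_smul]
  by_cases hl : modeSV X e l = 0
  · rw [hl, zero_smul]
  have hYl : modeSV Y e l ≠ 0 :=
    (singularValues_ne_zero_iff _).2 (((singularValues_ne_zero_iff _).1 hl).trans_le hle)
  have h := modeContract_comm hde (fun a => U d a k) (fun a => U e a l) Y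
  rw [hY0, map_zero, modeContract_of_svd (hU e) hYe, map_smul] at h
  rw [(smul_eq_zero.1 h).resolve_left hYl, smul_zero]

/-- rank trichotomy for nonzero tensors with simultaneous ordered
SVDs of all matricizations. -/
theorem rank_trichotomy (D : ℕ) (hD : 1 ≤ D) (n : Fin D → ℕ)
    (X Y : (∀ d, Fin (n d)) → ℝ) (hX : X ≠ 0) (hY : Y ≠ 0)
    (U : ∀ d, Matrix (Fin (n d)) (Fin (n d)) ℝ)
    (hU : ∀ d, U d * (U d)ᵀ = 1)
    (hSVD : ∀ d : Fin D,
      ∃ V : Matrix (∀ d' : {d' : Fin D // d' ≠ d}, Fin (n d'))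
                   (∀ d' : {d' : Fin D // d' ≠ d}, Fin (n d')) ℝ,
        V * Vᵀ = 1 ∧
        matricize X d = U d * rectDiagJ (modeSV X d) * Vᵀ ∧
        matricize Y d = U d * rectDiagJ (modeSV Y d) * Vᵀ) :
    ((∀ d : Fin D, (matricize Y d).rank < (matricize X d).rank) ∧
      ¬ (∀ d : Fin D, (matricize X d).rank < (matricize Y d).rank) ∧
      ¬ (∀ d : Fin D, (matricize X d).rank = (matricize Y d).rank)) ∨
    (¬ (∀ d : Fin D, (matricize Y d).rank < (matricize X d).rank) ∧
      (∀ d : Fin D, (matricize X d).rank < (matricize Y d).rank) ∧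
      ¬ (∀ d : Fin D, (matricize X d).rank = (matricize Y d).rank)) ∨
    (¬ (∀ d : Fin D, (matricize Y d).rank < (matricize X d).rank) ∧
      ¬ (∀ d : Fin D, (matricize X d).rank < (matricize Y d).rank) ∧
      (∀ d : Fin D, (matricize X d).rank = (matricize Y d).rank)) := by
  have hXY := fun d => rank_lt_of_rank_lt hU hSVD (d := d)
  have hYX := fun d => rank_lt_of_rank_lt hU
    (fun d => (hSVD d).imp fun _ h => ⟨h.1, h.2.2, h.2.1⟩) (d := d)
  let d₀ : Fin D := ⟨0, hD⟩
  rcases lt_trichotomy (matricize Y d₀).rank (matricize X d₀).rank with h | h | h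
  · exact .inl ⟨hXY d₀ h, fun h' => h.asymm (h' d₀), fun h' => h.ne' (h' d₀)⟩
  · exact .inr (.inr ⟨fun h' => (h' d₀).ne h, fun h' => (h' d₀).ne' h, fun d =>
      le_antisymm (not_lt.1 fun h' => (hXY d h' d₀).ne h)
        (not_lt.1 fun h' => (hYX d h' d₀).ne' h)⟩)
  · exact .inr (.inl ⟨fun h' => h.asymm (h' d₀), hYX d₀ h, fun h' => h.ne (h' d₀)⟩)
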